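/- There is no continuous function F : W_3 → Y_3 (each with the subspace topology from X_3) such that for every L_3-edge (a,b), the pair (F(a),F(b)) is an H_3-edge. -/

import Mathlib

open Classical

/-- The space `X₃ = 2^{ℕ³} × 2^ℕ`. -/
abbrev XThree : Type := (ℕ × ℕ × ℕ → Bool) × (ℕ → Bool)

/-- `T^x(m,k) = 0`, i.e. `x(m,k,a) = 1` for some `a`. -/
def lvl2Zero (x : ℕ × ℕ × ℕ → Bool) (m k : ℕ) : Prop := ∃ a : ℕ, x (m, k, a) = true

/-- `T^x(m) = 0`, i.e. `T^x(m,k) = 1` for some `k`. -/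
def lvl1Zero (x : ℕ × ℕ × ℕ → Bool) (m : ℕ) : Prop := ∃ k : ℕ, ¬ lvl2Zero x m k

/-- `T^x(⟨⟩) = 0`, i.e. `T^x(m) = 1` for some `m`. -/
def rootZero (x : ℕ × ℕ × ℕ → Bool) : Prop := ∃ m : ℕ, ¬ lvl1Zero x m

/-- The directed graph `K₃` on `X₃`: `(x,y)` is connected to `(x',y')` iff `x' = x`,
`T^x(⟨⟩) = 0`, and for the least `n` with `T^x(n) = 1`, `y` and `y'` agree except
at `n`, with `y(n) = 0` and `y'(n) = 1`. -/
def K3Edge (a b : XThree) : Prop :=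
  b.1 = a.1 ∧ rootZero a.1 ∧
  ∃ n : ℕ, ¬ lvl1Zero a.1 n ∧ (∀ m < n, lvl1Zero a.1 m) ∧
    a.2 n = false ∧ b.2 n = true ∧ ∀ m : ℕ, m ≠ n → a.2 m = b.2 m

/-- Membership in `W₃`, relative to a coding sequence `M`: for every finite
`m < n^x`, the number `k^x(m)` codes `(y(0),…,y(m))`, i.e. `M_{k^x(m)}` extends it. -/
def memW3 (M : ℕ → ℕ → Bool) (a : XThree) : Prop :=
  ∀ m k : ℕ, (∀ m' ≤ m, lvl1Zero a.1 m') → ¬ lvl2Zero a.1 m k →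
    (∀ k' < k, lvl2Zero a.1 m k') → ∀ i ≤ m, M k i = a.2 i

/-- `k^{x↾ℓ}(m)`: for the length-`ℓ` initial segment `t` of `x` (with respect to the
bijection `e : ℕ ≃ ℕ³`), the least `k` such that there is no `a` with `(m,k,a)` in
the domain of `t` and `t(m,k,a) = 1`. -/
noncomputable def kSeg (e : ℕ ≃ ℕ × ℕ × ℕ) (x : ℕ × ℕ × ℕ → Bool) (ℓ m : ℕ) : ℕ :=
  sInf {k : ℕ | ¬ ∃ a : ℕ, e.symm (m, k, a) < ℓ ∧ x (m, k, a) = true}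

open Classical in
/-- `n^{x↾ℓ}`: defined by recursion on `ℓ`, following the recursion defining `n^t`
for finite binary strings `t` (applied to the initial segments of `x`). -/
noncomputable def nSeg (e : ℕ ≃ ℕ × ℕ × ℕ) (x : ℕ × ℕ × ℕ → Bool) : ℕ → ℕ
  | 0 => 0
  | ℓ + 1 =>
    if ∃ m < nSeg e x ℓ, ∃ a : ℕ, e.symm (m, kSeg e x ℓ m, a) < ℓ + 1 ∧
        x (m, kSeg e x ℓ m, a) = true then
      sInf {m : ℕ | m < nSeg e x ℓ ∧ ∃ a : ℕ, e.symm (m, kSeg e x ℓ m, a) < ℓ + 1 ∧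
        x (m, kSeg e x ℓ m, a) = true}
    else nSeg e x ℓ + 1

/-- `n^x ∈ ℕ ∪ {∞}`: the supremum of the set of `n` such that `T^x(m) = 0` for
all `m < n`. -/
noncomputable def nVal (x : ℕ × ℕ × ℕ → Bool) : ℕ∞ :=
  sSup {N : ℕ∞ | ∃ n : ℕ, N = (n : ℕ∞) ∧ ∀ m < n, lvl1Zero x m}

/-- `k^x(m)`: the least `k` with `T^x(m,k) = 1`. -/
noncomputable def kVal (x : ℕ × ℕ × ℕ → Bool) (m : ℕ) : ℕ :=
  sInf {k : ℕ | ¬ lvl2Zero x m k}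

/-- `(x↾ℓ) ⊑_m x`: the length-`ℓ` initial segment `s` of `x` satisfies `m ≤ n^s`,
`m ≤ n^x`, and `k^s(j) = k^x(j)` for all `j < m`. -/
def sqSub (e : ℕ ≃ ℕ × ℕ × ℕ) (x : ℕ × ℕ × ℕ → Bool) (m ℓ : ℕ) : Prop :=
  m ≤ nSeg e x ℓ ∧ (m : ℕ∞) ≤ nVal x ∧ ∀ j < m, kSeg e x ℓ j = kVal x j

/-- `c^x(m)`: the least length of an initial segment `s` of `x` with `s ⊑_m x`. -/
noncomputable def cVal (e : ℕ ≃ ℕ × ℕ × ℕ) (x : ℕ × ℕ × ℕ → Bool) (m : ℕ) : ℕ :=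
  sInf {ℓ : ℕ | sqSub e x m ℓ}

/-- Membership in `Y₃`: for every finite `m < n^x`, the number `k^x(m)` codes the
string `(y(0),…,y(c^x(m)))`, i.e. `M_{k^x(m)}` extends it. -/
def memY3 (e : ℕ ≃ ℕ × ℕ × ℕ) (M : ℕ → ℕ → Bool) (a : XThree) : Prop :=
  ∀ m : ℕ, (m : ℕ∞) < nVal a.1 → ∀ i ≤ cVal e a.1 m, M (kVal a.1 m) i = a.2 i

/-- The directed graph `H₃` on `X₃`: `(x,y)` is connected to `(x',y')` iff both are
in `Y₃`, `x' = x`, `n^x` is finite, and `y, y'` agree except at `c^x(n^x)`, with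
`y(c^x(n^x)) = 0` and `y'(c^x(n^x)) = 1`. -/
def H3Edge (e : ℕ ≃ ℕ × ℕ × ℕ) (M : ℕ → ℕ → Bool) (a b : XThree) : Prop :=
  memY3 e M a ∧ memY3 e M b ∧ b.1 = a.1 ∧
  ∃ n : ℕ, nVal a.1 = (n : ℕ∞) ∧
    a.2 (cVal e a.1 n) = false ∧ b.2 (cVal e a.1 n) = true ∧
    ∀ i : ℕ, i ≠ cVal e a.1 n → a.2 i = b.2 i

open Filter Topology

theorem natCast_le_nVal_iff {x : ℕ × ℕ × ℕ → Bool} {n : ℕ} :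
    (n : ℕ∞) ≤ nVal x ↔ ∀ m < n, lvl1Zero x m := by
  constructor
  · intro h m hm
    by_contra hx
    have hle : nVal x ≤ (m : ℕ∞) := by
      refine sSup_le ?_
      rintro _ ⟨n', rfl, hn'⟩
      by_contra hlt
      have hlt' : m < n' := by exact_mod_cast not_le.1 hlt
      exact hx (hn' m hlt')
    have : n ≤ m := by exact_mod_cast h.trans hle
    omega
  · intro h
    exact le_sSup ⟨n, rfl, h⟩

theorem kVal_spec {x : ℕ × ℕ × ℕ → Bool} {m : ℕ} (h : lvl1Zero x m) (a : ℕ) :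
    x (m, kVal x m, a) = false := by
  have : ¬ lvl2Zero x m (kVal x m) := Nat.sInf_mem (s := {k | ¬ lvl2Zero x m k}) h
  simpa [lvl2Zero] using fun ha => this ⟨a, ha⟩

theorem kVal_eq {x : ℕ × ℕ × ℕ → Bool} {m k : ℕ} (hk : ∀ a, x (m, k, a) = false)
    (hlt : ∀ k' < k, lvl2Zero x m k') : kVal x m = k := by
  have hmem : k ∈ {k | ¬ lvl2Zero x m k} := by
    rintro ⟨a, ha⟩
    simp [hk a] at ha
  refine le_antisymm (Nat.sInf_le hmem) ?_
  by_contra hcon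
  exact Nat.sInf_mem (s := {k | ¬ lvl2Zero x m k}) ⟨k, hmem⟩ (hlt _ (not_le.1 hcon))

theorem kVal_lt {x : ℕ × ℕ × ℕ → Bool} {m k : ℕ} (hk : k < kVal x m) : lvl2Zero x m k := by
  simpa using Nat.notMem_of_lt_sInf hk

theorem lvl2Zero_of_lt_kSeg {e : ℕ ≃ ℕ × ℕ × ℕ} {x : ℕ × ℕ × ℕ → Bool} {ℓ m k : ℕ}
    (hk : k < kSeg e x ℓ m) : lvl2Zero x m k := by
  have := Nat.notMem_of_lt_sInf hk
  simp only [Set.mem_ofPred_eq, not_not] at this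
  obtain ⟨a, -, ha⟩ := this
  exact ⟨a, ha⟩

/-- Once all witnesses below the limit value have been seen, `kSeg` is stable. -/
theorem eventually_kSeg_eq_kVal (e : ℕ ≃ ℕ × ℕ × ℕ) {x : ℕ × ℕ × ℕ → Bool} {m : ℕ}
    (h : lvl1Zero x m) : ∀ᶠ ℓ in atTop, kSeg e x ℓ m = kVal x m := by
  have hseen : ∀ᶠ ℓ in atTop, ∀ k ∈ Set.Iio (kVal x m),
      ∃ a, e.symm (m, k, a) < ℓ ∧ x (m, k, a) = true := by
    refine (eventually_all_finite (Set.finite_Iio _)).2 fun k hk => ?_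
    obtain ⟨a, ha⟩ := kVal_lt hk
    filter_upwards [eventually_gt_atTop (e.symm (m, k, a))] with ℓ hℓ
    exact ⟨a, hℓ, ha⟩
  filter_upwards [hseen] with ℓ hℓ
  have hmem : kVal x m ∈
      {k : ℕ | ¬ ∃ a : ℕ, e.symm (m, k, a) < ℓ ∧ x (m, k, a) = true} := by
    rintro ⟨a, -, ha⟩
    simp [kVal_spec h a] at ha
  refine le_antisymm (Nat.sInf_le hmem) ?_
  by_contra hcon
  exact Nat.sInf_mem ⟨_, hmem⟩ (hℓ _ (not_le.1 hcon))

theorem exists_sqSub (e : ℕ ≃ ℕ × ℕ × ℕ) {x : ℕ × ℕ × ℕ → Bool} {n : ℕ}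
    (hn : (n : ℕ∞) ≤ nVal x) : ∃ ℓ, sqSub e x n ℓ := by
  have hz := natCast_le_nVal_iff.1 hn
  have hev : ∀ᶠ ℓ in atTop, ∀ m ∈ Set.Iio n, kSeg e x ℓ m = kVal x m :=
    (eventually_all_finite (Set.finite_Iio n)).2 fun m hm => eventually_kSeg_eq_kVal e (hz m hm)
  obtain ⟨L, hL⟩ := eventually_atTop.1 hev
  have hgrow : ∀ r, min n r ≤ nSeg e x (L + r) := by
    intro r
    induction r with
    | zero => simp
    | succ r ih =>
      rw [← add_assoc, nSeg]
      split_ifs with hex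
      · obtain ⟨hlt, a, -, ha⟩ := Nat.sInf_mem (s := {m : ℕ | m < nSeg e x (L + r) ∧
          ∃ a : ℕ, e.symm (m, kSeg e x (L + r) m, a) < L + r + 1 ∧
          x (m, kSeg e x (L + r) m, a) = true}) hex
        refine (min_le_left _ _).trans ?_
        by_contra hcon
        rw [hL (L + r) (by omega) _ (not_le.1 hcon), kVal_spec (hz _ (not_le.1 hcon))] at ha
        simp at ha
      · omega
  refine ⟨L + n, by simpa using hgrow n, hn, fun j hj => hL _ (by omega) j hj⟩

theorem sqSub_cVal (e : ℕ ≃ ℕ × ℕ × ℕ) {x : ℕ × ℕ × ℕ → Bool} {n : ℕ}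
    (hn : (n : ℕ∞) ≤ nVal x) : sqSub e x n (cVal e x n) :=
  Nat.sInf_mem (s := {ℓ | sqSub e x n ℓ}) (exists_sqSub e hn)

theorem kSeg_congr {e : ℕ ≃ ℕ × ℕ × ℕ} {x x' : ℕ × ℕ × ℕ → Bool} {L : ℕ}
    (h : ∀ p, e.symm p < L → x p = x' p) {ℓ : ℕ} (hℓ : ℓ ≤ L) (m : ℕ) :
    kSeg e x ℓ m = kSeg e x' ℓ m := by
  have hp : ∀ p, (e.symm p < ℓ ∧ x p = true) = (e.symm p < ℓ ∧ x' p = true) := fun p =>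
    propext (and_congr_right fun hlt => by rw [h p (hlt.trans_le hℓ)])
  simp only [kSeg, hp]

theorem nSeg_congr {e : ℕ ≃ ℕ × ℕ × ℕ} {x x' : ℕ × ℕ × ℕ → Bool} {L : ℕ}
    (h : ∀ p, e.symm p < L → x p = x' p) {ℓ : ℕ} (hℓ : ℓ ≤ L) :
    nSeg e x ℓ = nSeg e x' ℓ := by
  induction ℓ with
  | zero => rfl
  | succ ℓ ih =>
    have hp : ∀ p, (e.symm p < ℓ + 1 ∧ x p = true) = (e.symm p < ℓ + 1 ∧ x' p = true) := fun p =>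
      propext (and_congr_right fun hlt => by rw [h p (hlt.trans_le hℓ)])
    simp only [nSeg, ih (by omega), kSeg_congr h (show ℓ ≤ L by omega), hp]

theorem eventually_apply_eq {ι : Type*} {l : Filter ι} {I : Type*} {f : ι → I → Bool}
    {g : I → Bool} (h : Tendsto f l (𝓝 g)) (i : I) : ∀ᶠ j in l, f j i = g i := by
  have := tendsto_pi_nhds.1 h i
  rwa [nhds_discrete, tendsto_pure] at this

/-- The union of `H₃` with the diagonal is sequentially closed in `Y₃`. -/
theorem H3Edge.eq_or_of_tendsto {e : ℕ ≃ ℕ × ℕ × ℕ} {M : ℕ → ℕ → Bool} {u v : ℕ → XThree}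
    {a b : XThree} (hu : Tendsto u atTop (𝓝 a)) (hv : Tendsto v atTop (𝓝 b))
    (huv : ∀ j, H3Edge e M (u j) (v j)) (ha : memY3 e M a) (hb : memY3 e M b) :
    a = b ∨ H3Edge e M a b := by
  have hu1 := (continuous_fst.tendsto a).comp hu
  have hv1 := (continuous_fst.tendsto b).comp hv
  have hu2 := (continuous_snd.tendsto a).comp hu
  have hv2 := (continuous_snd.tendsto b).comp hv
  have hfst : b.1 = a.1 :=
    tendsto_nhds_unique (hv1.congr fun j => (huv j).2.2.1) hu1
  by_cases hsnd : a.2 = b.2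
  · exact Or.inl (Prod.ext hfst.symm hsnd)
  right
  obtain ⟨i, hi⟩ := Function.ne_iff.1 hsnd
  choose n hn hun hvn hne using fun j => (huv j).2.2.2
  have hc : ∀ᶠ j in atTop, cVal e (u j).1 (n j) = i := by
    filter_upwards [eventually_apply_eq hu2 i, eventually_apply_eq hv2 i] with j h1 h2
    by_contra hcon
    exact hi (h1.symm.trans ((hne j i (Ne.symm hcon)).trans h2))
  have hagree : ∀ᶠ j in atTop, ∀ p, e.symm p < i → (u j).1 p = a.1 p := by
    have hfin : {p | e.symm p < i}.Finite :=
      (Set.finite_Iio i).preimage e.symm.injective.injOn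
    exact (eventually_all_finite hfin).2 fun p _ => eventually_apply_eq hu1 p
  have hsq : ∀ᶠ j in atTop, sqSub e (u j).1 (n j) i := by
    filter_upwards [hc] with j hj
    have := sqSub_cVal e (hn j).ge
    rwa [hj] at this
  -- the values of `n` are bounded, so one of them recurs
  have hbdd : ∃ᶠ j in atTop, ∃ N ∈ Set.Iic (nSeg e a.1 i), n j = N := by
    refine Eventually.frequently ?_
    filter_upwards [hsq, hagree] with j h1 h2
    exact ⟨n j, by simpa [nSeg_congr h2 le_rfl] using h1.1, rfl⟩
  obtain ⟨N, hN⟩ : ∃ N, ∃ᶠ j in atTop, n j = N := by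
    by_contra hcon
    push Not at hcon
    refine hbdd ?_
    filter_upwards [(eventually_all_finite (Set.finite_Iic (nSeg e a.1 i))).2
      fun N _ => hcon N] with j hj
    rintro ⟨N, hNmem, rfl⟩
    exact hj _ hNmem rfl
  have hzero : ∀ l < N, ∀ t, a.1 (l, kSeg e a.1 i l, t) = false := by
    intro l hl t
    obtain ⟨j, rfl, h1, h2, h3⟩ := (hN.and_eventually (hsq.and (hagree.and
      (eventually_apply_eq hu1 (l, kSeg e a.1 i l, t))))).exists
    rw [← h3, ← kSeg_congr h2 le_rfl, h1.2.2 l hl]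
    exact kVal_spec (natCast_le_nVal_iff.1 (hn j).ge l hl) t
  have hk : ∀ l < N, kSeg e a.1 i l = kVal a.1 l := fun l hl =>
    (kVal_eq (hzero l hl) fun _ => lvl2Zero_of_lt_kSeg).symm
  have hNle : (N : ℕ∞) ≤ nVal a.1 := natCast_le_nVal_iff.2 fun l hl =>
    ⟨kSeg e a.1 i l, by rintro ⟨t, ht⟩; simp [hzero l hl t] at ht⟩
  obtain ⟨j, rfl, h1, h2, h3, h4, h5⟩ := (hN.and_eventually (hsq.and (hagree.and (hc.and
    ((eventually_apply_eq hu2 i).and (eventually_apply_eq hv2 i)))))).exists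
  have hcval : cVal e a.1 (n j) = i := by
    refine le_antisymm (Nat.sInf_le
      ⟨by simpa [nSeg_congr h2 le_rfl] using h1.1, hNle, hk⟩) ?_
    by_contra hcon
    have hlt := not_le.1 hcon
    obtain ⟨hs1, -, hs3⟩ := sqSub_cVal e hNle
    have hmem : sqSub e (u j).1 (n j) (cVal e a.1 (n j)) := by
      refine ⟨by rwa [nSeg_congr h2 hlt.le], h1.2.1, fun l hl => ?_⟩
      rw [kSeg_congr h2 hlt.le, hs3 l hl, ← hk l hl, ← kSeg_congr h2 le_rfl, h1.2.2 l hl]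
    exact hcon (h3.symm.le.trans (Nat.sInf_le hmem))
  refine ⟨ha, hb, hfst, n j, ?_, ?_, ?_, ?_⟩
  · refine le_antisymm (not_lt.1 fun hlt => hi ?_) hNle
    rw [← ha _ hlt i hcval.ge, ← hb (n j) (hfst ▸ hlt) i (by rw [hfst, hcval]), hfst]
  · rw [hcval, ← h4, Function.comp_apply, ← h3]
    exact hun j
  · rw [hcval, ← h5, Function.comp_apply, ← h3]
    exact hvn j
  · intro i' hi'
    rw [hcval] at hi'
    obtain ⟨j', g1, g2, g3⟩ :=
      (hc.and ((eventually_apply_eq hu2 i').and (eventually_apply_eq hv2 i'))).exists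
    exact g2.symm.trans ((hne j' i' (g1 ▸ hi')).trans g3)

theorem exists_ge_apply_zero_eq_false {M : ℕ → ℕ → Bool} (hM : DenseRange M) (N : ℕ) :
    ∃ k, N ≤ k ∧ M k 0 = false := by
  let U : Set (ℕ → Bool) :=
    {f | f 0 = false} ∩ ⋂ k ∈ Set.Iio N, {f | f (k + 1) = !M k (k + 1)}
  have hopen : ∀ (i : ℕ) (c : Bool), IsOpen {f : ℕ → Bool | f i = c} := fun i c =>
    (isOpen_discrete ({c} : Set Bool)).preimage (continuous_apply (A := fun _ : ℕ => Bool) i)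
  have hU : IsOpen U :=
    (hopen 0 _).inter ((Set.finite_Iio N).isOpen_biInter fun k _ => hopen (k + 1) _)
  obtain ⟨k, hk0, hk⟩ := hM.exists_mem_open hU
    ⟨fun i => if i = 0 then false else !M (i - 1) i, by simp [U]⟩
  refine ⟨k, ?_, hk0⟩
  by_contra hlt
  have := Set.mem_iInter₂.1 hk k (not_le.1 hlt)
  simp at this

/-- A point of the base space which vanishes exactly at the positions `(0, k, a)` with `R k a`. -/
noncomputable def zerosAt (R : ℕ → ℕ → Prop) : ℕ × ℕ × ℕ → Bool :=
  fun p => decide ¬ (p.1 = 0 ∧ R p.2.1 p.2.2)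

theorem zerosAt_zero (R : ℕ → ℕ → Prop) (k : ℕ) :
    lvl2Zero (zerosAt R) 0 k ↔ ∃ a, ¬ R k a := by
  simp [lvl2Zero, zerosAt]

theorem not_lvl1Zero_zerosAt_one (R : ℕ → ℕ → Prop) : ¬ lvl1Zero (zerosAt R) 1 := by
  simp [lvl1Zero, lvl2Zero, zerosAt]

theorem memW3_zerosAt {M : ℕ → ℕ → Bool} {R : ℕ → ℕ → Prop} {y : ℕ → Bool}
    (h : ∀ k, (∀ a, R k a) → (∀ k' < k, ∃ a, ¬ R k' a) → M k 0 = y 0) :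
    memW3 M (zerosAt R, y) := by
  intro m k hm hk hlt i hi
  obtain rfl : m = 0 := by
    by_contra hm0
    exact not_lvl1Zero_zerosAt_one R (hm 1 (by omega))
  obtain rfl : i = 0 := by omega
  refine h k ?_ fun k' hk' => (zerosAt_zero R k').1 (hlt k' hk')
  simpa [zerosAt_zero] using hk

theorem tendsto_zerosAt {R : ℕ → ℕ → ℕ → Prop} {S : ℕ → ℕ → Prop}
    (h : ∀ k a, ∀ᶠ j in atTop, R j k a ↔ S k a) (y : ℕ → Bool) :
    Tendsto (fun j => ((zerosAt (R j), y) : XThree)) atTop (𝓝 (zerosAt S, y)) := by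
  refine Tendsto.prodMk_nhds (tendsto_pi_nhds.2 fun p => ?_) tendsto_const_nhds
  rw [nhds_discrete, tendsto_pure]
  filter_upwards [h p.2.1 p.2.2] with j hj
  simp [zerosAt, hj]

/-- The sequence with initial values `b, c` and constantly `false` afterwards. -/
def twoBits (b c : Bool) : ℕ → Bool
  | 0 => b
  | 1 => c
  | _ + 2 => false

theorem K3Edge_one {R : ℕ → ℕ → Prop} {k : ℕ} (hk : ∀ a, R k a) (b : Bool) :
    K3Edge (zerosAt R, twoBits b false) (zerosAt R, twoBits b true) := by
  refine ⟨rfl, ⟨1, not_lvl1Zero_zerosAt_one R⟩, 1, not_lvl1Zero_zerosAt_one R, ?_, rfl, rfl, ?_⟩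
  · intro m hm
    obtain rfl : m = 0 := by omega
    exact ⟨k, by simp [zerosAt_zero, hk]⟩
  · rintro (_ | _ | m) hm <;> simp_all [twoBits]

theorem K3Edge_zero {R : ℕ → ℕ → Prop} (hR : ∀ k, ∃ a, ¬ R k a) (c : Bool) :
    K3Edge (zerosAt R, twoBits false c) (zerosAt R, twoBits true c) := by
  have h0 : ¬ lvl1Zero (zerosAt R) 0 := by
    rintro ⟨k, hk⟩
    exact hk ((zerosAt_zero R k).2 (hR k))
  refine ⟨rfl, ⟨0, h0⟩, 0, h0, by simp, rfl, rfl, ?_⟩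
  rintro (_ | _ | m) hm <;> simp_all [twoBits]

theorem H3Edge.irrefl {e : ℕ ≃ ℕ × ℕ × ℕ} {M : ℕ → ℕ → Bool} {a : XThree} :
    ¬ H3Edge e M a a := by
  rintro ⟨-, -, -, n, -, h1, h2, -⟩
  simp [h1] at h2

/-- No target of an `H₃`-edge is the source of another one. -/
theorem H3Edge.not_comp {e : ℕ ≃ ℕ × ℕ × ℕ} {M : ℕ → ℕ → Bool} {a b c : XThree}
    (hab : H3Edge e M a b) : ¬ H3Edge e M b c := by
  rintro ⟨-, -, -, n', hn', h', -⟩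
  obtain ⟨-, -, h1, n, hn, -, h, -⟩ := hab
  rw [h1, hn, Nat.cast_inj] at hn'
  subst hn'
  rw [h1, h] at h'
  simp at h'

/-- There is no continuous `F : W₃ → Y₃` (each with the subspace
topology from `X₃`) mapping every `L₃`-edge (a `K₃`-edge with both endpoints in
`W₃`) to an `H₃`-edge. -/
theorem no_continuous_hom_L3_to_H3 (e : ℕ ≃ ℕ × ℕ × ℕ) (M : ℕ → ℕ → Bool)
    (hM : DenseRange M) :
    ¬ ∃ F : {a : XThree // memW3 M a} → {a : XThree // memY3 e M a},
      Continuous F ∧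
      ∀ a b : {a : XThree // memW3 M a},
        (K3Edge a.1 b.1 ∧ memW3 M a.1 ∧ memW3 M b.1) →
        H3Edge e M (F a).1 (F b).1 := by
  rintro ⟨F, hF, hom⟩
  have mem_of_free : ∀ {R : ℕ → ℕ → Prop} (y : ℕ → Bool), (∀ k, ∃ a, ¬ R k a) →
      memW3 M (zerosAt R, y) := fun {R} y hR =>
    memW3_zerosAt fun k hk _ => absurd hk (by simpa using hR k)
  -- flipping coordinate `1` does not change `F` above points with `n^x = 0` of a special form
  have key : ∀ (k₀ i : ℕ) (h : ∀ k, ∃ a, ¬ (k = k₀ ∧ a < i)),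
      F ⟨(zerosAt fun k a => k = k₀ ∧ a < i, twoBits false false), mem_of_free _ h⟩ =
      F ⟨(zerosAt fun k a => k = k₀ ∧ a < i, twoBits false true), mem_of_free _ h⟩ := by
    intro k₀ i h
    choose k hkge hk using exists_ge_apply_zero_eq_false hM
    let R : ℕ → ℕ → ℕ → Prop := fun j k' a => (k' = k₀ ∧ a < i) ∨ k' = k j
    have hmem : ∀ j c, memW3 M (zerosAt (R j), twoBits false c) := by
      refine fun j c => memW3_zerosAt fun k' hk' _ => ?_
      obtain rfl : k' = k j := by
        obtain ⟨a, ha⟩ := h k'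
        exact (hk' a).resolve_left ha
      exact hk j
    have hlim : ∀ c, Tendsto
        (fun j => (F ⟨(zerosAt (R j), twoBits false c), hmem j c⟩).1) atTop
        (𝓝 (F ⟨(zerosAt fun k a => k = k₀ ∧ a < i, twoBits false c), mem_of_free _ h⟩).1) := by
      refine fun c => ((continuous_subtype_val.comp hF).tendsto _).comp
        (tendsto_subtype_rng.2 (tendsto_zerosAt (fun k' a => ?_) _))
      filter_upwards [eventually_gt_atTop k'] with j hj
      have : k' ≠ k j := by have := hkge j; omega
      simp [R, this]
    rcases H3Edge.eq_or_of_tendsto (hlim false) (hlim true)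
      (fun j => hom _ _ ⟨K3Edge_one (k := k j) (fun a => Or.inr rfl) false, hmem j _, hmem j _⟩)
      (F _).2 (F _).2 with heq | hedge
    · exact Subtype.ext heq
    · exact absurd (hom ⟨_, mem_of_free _ h⟩ ⟨_, mem_of_free _ h⟩
        ⟨K3Edge_zero h true, mem_of_free _ h, mem_of_free _ h⟩) hedge.not_comp
  obtain ⟨k₀, -, hk₀⟩ := exists_ge_apply_zero_eq_false hM 0
  have hfree : ∀ i k : ℕ, ∃ a, ¬ (k = k₀ ∧ a < i) :=
    fun i k => ⟨i, fun h => lt_irrefl i h.2⟩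
  have hmem : ∀ c, memW3 M (zerosAt fun k _ => k = k₀, twoBits false c) := fun c =>
    memW3_zerosAt fun k hk _ => by rw [hk 0, hk₀]; rfl
  have hlim : ∀ c, Tendsto (fun i =>
      F ⟨(zerosAt fun k a => k = k₀ ∧ a < i, twoBits false c), mem_of_free _ (hfree i)⟩) atTop
      (𝓝 (F ⟨(zerosAt fun k _ => k = k₀, twoBits false c), hmem c⟩)) := by
    refine fun c => (hF.tendsto _).comp
      (tendsto_subtype_rng.2 (tendsto_zerosAt (fun k a => ?_) _))
    filter_upwards [eventually_gt_atTop a] with i hi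
    simp [hi]
  have heq := tendsto_nhds_unique (hlim false)
    ((hlim true).congr fun i => (key k₀ i (hfree i)).symm)
  have hedge := hom ⟨_, hmem false⟩ ⟨_, hmem true⟩
    ⟨K3Edge_one (k := k₀) (fun _ => rfl) false, hmem _, hmem _⟩
  rw [heq] at hedge
  exact H3Edge.irrefl hedge
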